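/- Let E ⊆ ℝⁿ be a measurable set with finite perimeter and let Q = {x ∈ ℝⁿ : Σᵢ xᵢ² < 1, a < x_n < 1} with a ≤ 1/2. Then the isoperimetric inequality min{H_n(Q ∩ E), H_n(Q \ E)} ≤ c_n · P_Q(E)^{n/(n−1)} holds, where c_n > 0 is a constant depending only on the dimension n. -/

import Mathlib

open MeasureTheory Metric Set Filter
open scoped ENNReal NNReal Topology RealInnerProductSpace

noncomputable section

/-- Euclidean space `ℝⁿ`. -/
abbrev Euc (n : ℕ) := EuclideanSpace ℝ (Fin n)

/-- The `(n-1)`-dimensional Hausdorff measure `μ` on `ℝⁿ`. -/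
def hm (n : ℕ) : Measure (Euc n) := μH[(n : ℝ) - 1]

/-- Divergence of a vector field on `ℝⁿ`. -/
def vdiv {n : ℕ} (φ : Euc n → Euc n) (x : Euc n) : ℝ :=
  ∑ i, ⟪fderiv ℝ φ x (EuclideanSpace.single i 1), EuclideanSpace.single i 1⟫

/-- The `BV` norm (variation of the gradient) of `f` on an open set `Ω`:
`‖f‖_{BV(Ω)} = sup { ∫_Ω f div φ : φ ∈ C¹_c(Ω, ℝⁿ), |φ| ≤ 1 }`. -/
def bvNorm {n : ℕ} (Ω : Set (Euc n)) (f : Euc n → ℝ) : ℝ≥0∞ :=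
  ⨆ (φ : Euc n → Euc n) (_ : ContDiff ℝ 1 φ) (_ : HasCompactSupport φ)
    (_ : tsupport φ ⊆ Ω) (_ : ∀ x, ‖φ x‖ ≤ 1),
    ENNReal.ofReal (∫ x in Ω, f x * vdiv φ x)

/-- The perimeter `P_Ω(E)` of `E` relative to `Ω`. -/
def perim {n : ℕ} (Ω E : Set (Euc n)) : ℝ≥0∞ :=
  bvNorm Ω (E.indicator fun _ => (1 : ℝ))

/-- `f ∈ BV(Ω)`: locally summable in `Ω`, the gradient being a (finite) vector charge. -/
def MemBV {n : ℕ} (Ω : Set (Euc n)) (f : Euc n → ℝ) : Prop :=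
  LocallyIntegrableOn f Ω volume ∧ bvNorm Ω f < ⊤

/-- The half ball `B^ν_x(r)`. -/
def halfBall {n : ℕ} (x ν : Euc n) (r : ℝ) : Set (Euc n) :=
  ball x r ∩ {y | 0 ≤ ⟪y - x, ν⟫}

/-- Volume of the unit ball in `ℝⁿ`. -/
def ubv (n : ℕ) : ℝ := (volume (ball (0 : Euc n) 1)).toReal

/-- `Θ^ν_E(x) = d`: the one-sided density of `E` at `x` with respect to `ν` equals `d`. -/
def HasOneSidedDensity {n : ℕ} (E : Set (Euc n)) (x ν : Euc n) (d : ℝ) : Prop :=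
  Tendsto (fun r : ℝ => 2 * (volume (halfBall x ν r ∩ E)).toReal / (ubv n * r ^ n))
    (𝓝[>] 0) (𝓝 d)

/-- `ν` is a (unit) normal to `A` at `x`: the hyperplane orthogonal to `ν` is an
approximate tangent plane of `A` at `x`. -/
def IsNormalAt {n : ℕ} (A : Set (Euc n)) (x ν : Euc n) : Prop :=
  ‖ν‖ = 1 ∧ ∀ ε > (0 : ℝ),
    Tendsto (fun r : ℝ =>
        (hm n ((A ∩ ball x r) \ {y | |⟪y - x, ν⟫| ≤ ε * r})).toReal / r ^ (n - 1))
      (𝓝[>] 0) (𝓝 0)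

/-- A regular point of `A`: a point where an approximate tangent plane (hence a normal)
exists and `A` has `(n-1)`-density one. -/
def RegularPoint {n : ℕ} (A : Set (Euc n)) (x : Euc n) : Prop :=
  (∃ ν, IsNormalAt A x ν) ∧
    Tendsto (fun r : ℝ => (hm n (A ∩ ball x r)).toReal / (ubv (n - 1) * r ^ (n - 1)))
      (𝓝[>] 0) (𝓝 1)

/-- `A ⊆ ℝⁿ` is countably `(n-1)`-rectifiable. -/
def CountablyRectifiable {n : ℕ} (A : Set (Euc n)) : Prop :=
  MeasurableSet A ∧
    ∃ g : ℕ → Euc (n - 1) → Euc n,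
      (∀ i, ContDiff ℝ 1 (g i)) ∧ hm n (A \ ⋃ i, range (g i)) = 0

/-- A measurable field of unit normals to `A`. -/
def NormalField {n : ℕ} (A : Set (Euc n)) (ν : Euc n → Euc n) : Prop :=
  Measurable ν ∧ (∀ x, ‖ν x‖ = 1) ∧
    ∀ᵐ x ∂(hm n).restrict A, RegularPoint A x → IsNormalAt A x (ν x)

/-- `ν` is the normal to `E` at `x` in the sense of Federer. -/
def IsFedererNormal {n : ℕ} (E : Set (Euc n)) (x ν : Euc n) : Prop :=
  ‖ν‖ = 1 ∧ HasOneSidedDensity E x (-ν) 1 ∧ HasOneSidedDensity E x ν 0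

/-- The reduced boundary `∂*E`: points where a Federer normal exists. -/
def redBdry {n : ℕ} (E : Set (Euc n)) : Set (Euc n) := {x | ∃ ν, IsFedererNormal E x ν}

/-- `Γ`: points of `∂Ω` where `Ω` has one-sided density one for at least one normal. -/
def Gamma {n : ℕ} (Ω : Set (Euc n)) : Set (Euc n) :=
  {x ∈ frontier Ω | ∃ ν, IsNormalAt (frontier Ω) x ν ∧ HasOneSidedDensity Ω x ν 1}

/-- `∂^ν_A E`, for a field `ν` of normals. -/
def nuBdry {n : ℕ} (A : Set (Euc n)) (ν : Euc n → Euc n) (E : Set (Euc n)) : Set (Euc n) :=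
  {x ∈ A | HasOneSidedDensity E x (ν x) 1}

/-- `∂²_A E = ∂^ν_A E ∩ ∂^{-ν}_A E`. -/
def bothBdry {n : ℕ} (A : Set (Euc n)) (ν : Euc n → Euc n) (E : Set (Euc n)) : Set (Euc n) :=
  nuBdry A ν E ∩ nuBdry A (fun x => -ν x) E

/-- The level set `E_t = {x ∈ Ω : f x > t}`. -/
def levelSet {n : ℕ} (Ω : Set (Euc n)) (f : Euc n → ℝ) (t : ℝ) : Set (Euc n) :=
  {x ∈ Ω | t < f x}

/-- `f` is `BV`-similar on `Ω`: almost all level sets have finite perimeter. -/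
def BVSimilar {n : ℕ} (Ω : Set (Euc n)) (f : Euc n → ℝ) : Prop :=
  ∀ᵐ t : ℝ, perim univ (levelSet Ω f t) < ⊤

/-- The (rough) trace `f^ν(x) = sup {t : x ∈ ∂^ν_A E_t}` (with `sup ∅ = -∞`). -/
def trace {n : ℕ} (Ω A : Set (Euc n)) (ν : Euc n → Euc n) (f : Euc n → ℝ) (x : Euc n) :
    EReal :=
  sSup ((fun t : ℝ => (t : EReal)) '' {t : ℝ | x ∈ nuBdry A ν (levelSet Ω f t)})

/-- The upper trace `f* = max (f^ν, f^{-ν})` on the boundary of `Ω`. -/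
def upperTrace {n : ℕ} (Ω : Set (Euc n)) (ν : Euc n → Euc n) (f : Euc n → ℝ) (x : Euc n) :
    EReal :=
  max (trace Ω (frontier Ω) ν f x) (trace Ω (frontier Ω) (fun y => -ν y) f x)

/-- The lower trace `f_* = min (f^ν, f^{-ν})` on the boundary of `Ω`. -/
def lowerTrace {n : ℕ} (Ω : Set (Euc n)) (ν : Euc n → Euc n) (f : Euc n → ℝ) (x : Euc n) :
    EReal :=
  min (trace Ω (frontier Ω) ν f x) (trace Ω (frontier Ω) (fun y => -ν y) f x)

/-- The canonical map `EReal → ℝ≥0∞` (negative values to `0`). -/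
def erealToENNReal (a : EReal) : ℝ≥0∞ := if a = ⊤ then ⊤ else ENNReal.ofReal a.toReal

/-- The norm `‖f‖_tr` of the trace of `f` on `∂Ω`:
`∫_{∂*Ω} |f*| dμ + ∫_{∂²_Γ Ω} (f* - f_*) dμ`. -/
def traceNorm {n : ℕ} (Ω : Set (Euc n)) (ν : Euc n → Euc n) (f : Euc n → ℝ) : ℝ≥0∞ :=
  (∫⁻ x in redBdry Ω, (upperTrace Ω ν f x).abs ∂hm n) +
    ∫⁻ x in bothBdry (frontier Ω) ν Ω,
      erealToENNReal (upperTrace Ω ν f x - lowerTrace Ω ν f x) ∂hm n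

/-- A region: a nonempty open connected subset of `ℝⁿ`. -/
def IsRegion {n : ℕ} (Ω : Set (Euc n)) : Prop := IsOpen Ω ∧ IsConnected Ω

/-- `τ_A`: the infimum of constants `β` such that `μ(∂*E ∩ Γ) ≤ β μ(∂*E ∩ Ω)` for all
`E ⊆ Ω` with `Vol(A ∩ E) + μ(A ∩ ∂*E) = 0`. -/
def tau {n : ℕ} (Ω A : Set (Euc n)) : ℝ≥0∞ :=
  sInf {β : ℝ≥0∞ | ∀ E : Set (Euc n), E ⊆ Ω → MeasurableSet E →
    volume (A ∩ E) = 0 → hm n (A ∩ redBdry E) = 0 →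
    hm n (redBdry E ∩ Gamma Ω) ≤ β * hm n (redBdry E ∩ Ω)}

/-- Canonical monotone extension of `φ : ℝ → ℝ` to `EReal`, sending `-∞` to `inf φ`
and `+∞` to `sup φ`. -/
def erealExt (φ : ℝ → ℝ) (a : EReal) : EReal :=
  if a = ⊥ then sInf (Set.range fun t : ℝ => (φ t : EReal))
  else if a = ⊤ then sSup (Set.range fun t : ℝ => (φ t : EReal))
  else (φ a.toReal : EReal)

/-- Integral of a function against a signed measure (a charge). -/
def sint {n : ℕ} (σ : SignedMeasure (Euc n)) (g : Euc n → ℝ) : ℝ :=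
  ∫ x, g x ∂σ.toJordanDecomposition.posPart - ∫ x, g x ∂σ.toJordanDecomposition.negPart

/-- `σ` is the vector charge `grad f` on `Ω` (componentwise), characterized by
integration by parts against test functions compactly supported in `Ω`. -/
def IsGradCharge {n : ℕ} (Ω : Set (Euc n)) (f : Euc n → ℝ)
    (σ : Fin n → SignedMeasure (Euc n)) : Prop :=
  ∀ φ : Euc n → ℝ, ContDiff ℝ 1 φ → HasCompactSupport φ → tsupport φ ⊆ Ω →
    ∀ i : Fin n,
      ∫ x in Ω, f x * fderiv ℝ φ x (EuclideanSpace.single i 1) = -sint (σ i) φ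

/-- A standard field of unit normals to `∂Ω`: a measurable field of unit normals that at
points of the reduced boundary `∂*Ω` is directed opposite to the Federer normal. -/
def StandardField {n : ℕ} (Ω : Set (Euc n)) (ν : Euc n → Euc n) : Prop :=
  NormalField (frontier Ω) ν ∧
    ∀ x ∈ redBdry Ω, ∀ w : Euc n, IsFedererNormal Ω x w → ν x = -w

/-- Any admissible test field bounds the perimeter from below. -/
theorem ofReal_integral_le_perim {n : ℕ} {Ω : Set (Euc n)} (E : Set (Euc n)) {φ : Euc n → Euc n}
    (h1 : ContDiff ℝ 1 φ) (h2 : HasCompactSupport φ) (h3 : tsupport φ ⊆ Ω)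
    (h4 : ∀ x, ‖φ x‖ ≤ 1) :
    ENNReal.ofReal (∫ x in Ω, E.indicator (fun _ => (1 : ℝ)) x * vdiv φ x) ≤ perim Ω E := by
  unfold perim bvNorm
  exact le_iSup_of_le φ <| le_iSup_of_le h1 <| le_iSup_of_le h2 <| le_iSup_of_le h3 <|
    le_iSup_of_le h4 le_rfl

theorem perim_le_iff {n : ℕ} {Ω E : Set (Euc n)} {b : ℝ≥0∞} :
    perim Ω E ≤ b ↔ ∀ φ : Euc n → Euc n, ContDiff ℝ 1 φ → HasCompactSupport φ → tsupport φ ⊆ Ω →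
      (∀ x, ‖φ x‖ ≤ 1) →
      ENNReal.ofReal (∫ x in Ω, E.indicator (fun _ => (1 : ℝ)) x * vdiv φ x) ≤ b := by
  simp only [perim, bvNorm, iSup_le_iff]

theorem vdiv_eq_zero_of_notMem_tsupport {n : ℕ} {φ : Euc n → Euc n} {x : Euc n}
    (hx : x ∉ tsupport φ) : vdiv φ x = 0 := by
  have : fderiv ℝ φ x = 0 := by
    by_contra h
    exact hx (support_fderiv_subset ℝ h)
  simp [vdiv, this]

theorem setIntegral_mul_vdiv {n : ℕ} {Ω : Set (Euc n)} (f : Euc n → ℝ) {φ : Euc n → Euc n}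
    (h : tsupport φ ⊆ Ω) : ∫ x in Ω, f x * vdiv φ x = ∫ x, f x * vdiv φ x :=
  setIntegral_eq_integral_of_forall_compl_eq_zero fun x hx => by
    rw [vdiv_eq_zero_of_notMem_tsupport fun h' => hx (h h'), mul_zero]

theorem continuous_vdiv {n : ℕ} {φ : Euc n → Euc n} (h : ContDiff ℝ 1 φ) :
    Continuous (vdiv φ) := by
  have := h.continuous_fderiv one_ne_zero
  unfold vdiv
  fun_prop

theorem indicator_one_mul_eq {α : Type*} (E : Set α) (g : α → ℝ) :
    (fun x => E.indicator (fun _ => (1 : ℝ)) x * g x) = E.indicator g := by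
  ext x
  by_cases hx : x ∈ E <;> simp [hx]

theorem integrable_indicator_mul_vdiv {n : ℕ} {E : Set (Euc n)} (hE : MeasurableSet E)
    {φ : Euc n → Euc n} (h1 : ContDiff ℝ 1 φ) (h2 : HasCompactSupport φ) :
    Integrable (fun x => E.indicator (fun _ => (1 : ℝ)) x * vdiv φ x) := by
  have hi : Integrable (vdiv φ) :=
    (continuous_vdiv h1).integrable_of_hasCompactSupport
      (HasCompactSupport.intro h2 fun x hx => vdiv_eq_zero_of_notMem_tsupport hx)
  rw [indicator_one_mul_eq]
  exact hi.indicator hE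

theorem vdiv_add {n : ℕ} {φ ψ : Euc n → Euc n} (h1 : ContDiff ℝ 1 φ) (h2 : ContDiff ℝ 1 ψ)
    (x : Euc n) : vdiv (φ + ψ) x = vdiv φ x + vdiv ψ x := by
  simp only [vdiv]
  rw [fderiv_add (h1.differentiable one_ne_zero x) (h2.differentiable one_ne_zero x),
    ← Finset.sum_add_distrib]
  exact Finset.sum_congr rfl fun i _ => by rw [add_apply, inner_add_left]

theorem vdiv_smul_const {n : ℕ} {Ψ : Euc n → ℝ} (h : Differentiable ℝ Ψ) (w x : Euc n) :
    vdiv (fun y => Ψ y • w) x = fderiv ℝ Ψ x w := by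
  have hw : w = ∑ i, w i • EuclideanSpace.single i (1 : ℝ) := by
    ext j
    simp [Finset.sum_apply, Pi.single_apply]
  conv_rhs => rw [hw, map_sum]
  simp only [vdiv]
  refine Finset.sum_congr rfl fun i _ => ?_
  rw [fderiv_smul_const (h x), ContinuousLinearMap.smulRight_apply, inner_smul_left, map_smul]
  simp [EuclideanSpace.inner_single_right, mul_comm]

theorem perim_mono {n : ℕ} {U Ω : Set (Euc n)} (E : Set (Euc n)) (h : U ⊆ Ω) :
    perim U E ≤ perim Ω E := by
  refine perim_le_iff.2 fun φ h1 h2 h3 h4 => ?_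
  rw [setIntegral_mul_vdiv _ h3, ← setIntegral_mul_vdiv _ (h3.trans h)]
  exact ofReal_integral_le_perim E h1 h2 (h3.trans h) h4

/-- The perimeter is superadditive over disjoint sets. -/
theorem perim_add_le {n : ℕ} {U V Ω E : Set (Euc n)} (hE : MeasurableSet E) (hU : U ⊆ Ω)
    (hV : V ⊆ Ω) (hUV : Disjoint U V) : perim U E + perim V E ≤ perim Ω E := by
  have key : ∀ φ : Euc n → Euc n, ContDiff ℝ 1 φ → HasCompactSupport φ → tsupport φ ⊆ U →
      (∀ x, ‖φ x‖ ≤ 1) → ∀ ψ : Euc n → Euc n, ContDiff ℝ 1 ψ → HasCompactSupport ψ →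
      tsupport ψ ⊆ V → (∀ x, ‖ψ x‖ ≤ 1) →
      ENNReal.ofReal (∫ x in U, E.indicator (fun _ => (1 : ℝ)) x * vdiv φ x) +
      ENNReal.ofReal (∫ x in V, E.indicator (fun _ => (1 : ℝ)) x * vdiv ψ x) ≤ perim Ω E := by
    intro φ h1 h2 h3 h4 ψ k1 k2 k3 k4
    rcases le_total (∫ x in U, E.indicator (fun _ => (1 : ℝ)) x * vdiv φ x) 0 with ha | ha
    · rw [ENNReal.ofReal_of_nonpos ha, zero_add]
      exact (ofReal_integral_le_perim E k1 k2 k3 k4).trans (perim_mono E hV)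
    rcases le_total (∫ x in V, E.indicator (fun _ => (1 : ℝ)) x * vdiv ψ x) 0 with hb | hb
    · rw [ENNReal.ofReal_of_nonpos hb, add_zero]
      exact (ofReal_integral_le_perim E h1 h2 h3 h4).trans (perim_mono E hU)
    have hs : tsupport (φ + ψ) ⊆ Ω :=
      (tsupport_add φ ψ).trans (union_subset (h3.trans hU) (k3.trans hV))
    rw [← ENNReal.ofReal_add ha hb, setIntegral_mul_vdiv _ h3, setIntegral_mul_vdiv _ k3,
      ← integral_add (integrable_indicator_mul_vdiv hE h1 h2)
        (integrable_indicator_mul_vdiv hE k1 k2)]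
    have : ∀ x, E.indicator (fun _ => (1 : ℝ)) x * vdiv φ x
        + E.indicator (fun _ => (1 : ℝ)) x * vdiv ψ x
        = E.indicator (fun _ => (1 : ℝ)) x * vdiv (φ + ψ) x := fun x => by
      rw [vdiv_add h1 k1, mul_add]
    simp only [this]
    rw [← setIntegral_mul_vdiv _ hs]
    refine ofReal_integral_le_perim E (h1.add k1) (h2.add k2) hs fun x => ?_
    by_cases hx : x ∈ U
    · have : ψ x = 0 := image_eq_zero_of_notMem_tsupport
        fun h => hUV.notMem_of_mem_left hx (k3 h)
      simpa [this] using h4 x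
    · have : φ x = 0 := image_eq_zero_of_notMem_tsupport fun h => hx (h3 h)
      simpa [this] using k4 x
  have key2 : ∀ φ : Euc n → Euc n, ContDiff ℝ 1 φ → HasCompactSupport φ → tsupport φ ⊆ U →
      (∀ x, ‖φ x‖ ≤ 1) →
      perim V E + ENNReal.ofReal (∫ x in U, E.indicator (fun _ => (1 : ℝ)) x * vdiv φ x)
        ≤ perim Ω E := by
    intro φ h1 h2 h3 h4
    refine add_le_of_le_tsub_right_of_le ?_ (perim_le_iff.2 fun ψ k1 k2 k3 k4 => ?_)
    · exact (ofReal_integral_le_perim E h1 h2 h3 h4).trans (perim_mono E hU)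
    · exact ENNReal.le_sub_of_add_le_left ENNReal.ofReal_ne_top (key φ h1 h2 h3 h4 ψ k1 k2 k3 k4)
  by_cases hT : perim V E = ⊤
  · exact (le_of_eq (by simp [hT])).trans (hT ▸ perim_mono E hV)
  rw [add_comm]
  refine add_le_of_le_tsub_left_of_le (perim_mono E hV) (perim_le_iff.2 fun φ h1 h2 h3 h4 => ?_)
  exact ENNReal.le_sub_of_add_le_left hT (key2 φ h1 h2 h3 h4)

theorem sum_perim_le {n : ℕ} {ι : Type*} {Ω E : Set (Euc n)} (hE : MeasurableSet E)
    (U : ι → Set (Euc n)) (s : Finset ι) (hU : ∀ i ∈ s, U i ⊆ Ω)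
    (hd : (s : Set ι).PairwiseDisjoint U) : ∑ i ∈ s, perim (U i) E ≤ perim Ω E := by
  classical
  suffices H : ∑ i ∈ s, perim (U i) E ≤ perim (⋃ i ∈ s, U i) E from
    H.trans (perim_mono E (iUnion₂_subset hU))
  clear hU
  induction s using Finset.induction_on with
  | empty => simp
  | insert a s ha ih =>
    rw [Finset.sum_insert ha]
    refine (add_le_add le_rfl (ih (hd.subset (by simp)))).trans
      (perim_add_le hE ?_ ?_ ?_)
    · exact subset_biUnion_of_mem (u := U) (Finset.mem_insert_self a s)
    · exact biUnion_subset_biUnion_left fun i hi => Finset.mem_insert_of_mem hi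
    · refine disjoint_iUnion₂_right.2 fun i hi => hd (by simp) (by simp [hi]) ?_
      rintro rfl
      exact ha hi

theorem tsum_perim_le {n : ℕ} {ι : Type*} {Ω E : Set (Euc n)} (hE : MeasurableSet E)
    (U : ι → Set (Euc n)) (hU : ∀ i, U i ⊆ Ω)
    (hd : Pairwise (Function.onFun Disjoint U)) : ∑' i, perim (U i) E ≤ perim Ω E := by
  rw [ENNReal.tsum_eq_iSup_sum]
  exact iSup_le fun s => sum_perim_le hE U s (fun i _ => hU i) (hd.set_pairwise _)

/-- The average of `η` over the segments `[y - h, y]`. -/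
def segmentAverage {n : ℕ} (η : Euc n → ℝ) (h y : Euc n) : ℝ := ∫ t in (0 : ℝ)..1, η (y - t • h)

theorem contDiff_segmentAverage {n : ℕ} {η : Euc n → ℝ} (h1 : ContDiff ℝ 1 η)
    (h2 : HasCompactSupport η) (h : Euc n) : ContDiff ℝ 1 (segmentAverage η h) := by
  set μ : Measure (Euc n) := Measure.map (fun t : ℝ => t • h) (volume.restrict (Ioc 0 1)) with hμ
  have hm : Measurable fun t : ℝ => t • h := by fun_prop
  have hfin : IsFiniteMeasure μ := Measure.isFiniteMeasure_map _ _
  have hc := h2.contDiff_convolution_right (μ := μ) (f := fun _ => (1 : ℝ)) (n := 1)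
    (ContinuousLinearMap.lsmul ℝ ℝ) (locallyIntegrable_const 1) h1
  refine (congrArg (ContDiff ℝ 1) (funext fun y => ?_)).mpr hc
  rw [MeasureTheory.convolution_def, hμ, integral_map hm.aemeasurable, segmentAverage,
    intervalIntegral.integral_of_le zero_le_one]
  · simp
  · have := h1.continuous
    exact Continuous.aestronglyMeasurable (by fun_prop)

theorem fderiv_segmentAverage {n : ℕ} {η : Euc n → ℝ} (h1 : ContDiff ℝ 1 η)
    (h2 : HasCompactSupport η) (h y : Euc n) :
    fderiv ℝ (segmentAverage η h) y h = η y - η (y - h) := by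
  have hd := ((contDiff_segmentAverage h1 h2 h).differentiable one_ne_zero y).hasFDerivAt
  have hη := h1.continuous
  have e : HasDerivAt (fun s : ℝ => segmentAverage η h (y + s • h))
      (fderiv ℝ (segmentAverage η h) y h) 0 := by
    have hl : HasDerivAt (fun s : ℝ => y + s • h) h 0 := by
      simpa using ((hasDerivAt_id (0 : ℝ)).smul_const h).const_add y
    exact HasFDerivAt.comp_hasDerivAt (0 : ℝ) (by simpa using hd) hl
  have hg : Continuous fun u : ℝ => η (y + u • h) := by fun_prop
  have e2 : (fun s : ℝ => segmentAverage η h (y + s • h)) =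
      fun s => (∫ u in (0 : ℝ)..s, η (y + u • h)) - ∫ u in (0 : ℝ)..(s - 1), η (y + u • h) := by
    ext s
    rw [intervalIntegral.integral_interval_sub_left (hg.intervalIntegrable _ _)
      (hg.intervalIntegrable _ _), segmentAverage]
    have := intervalIntegral.integral_comp_sub_left (a := 0) (b := 1)
      (fun u : ℝ => η (y + u • h)) s
    rw [sub_zero] at this
    rw [← this]
    refine intervalIntegral.integral_congr fun t _ => ?_
    congr 1
    module
  have e3 : HasDerivAt (fun s : ℝ => segmentAverage η h (y + s • h)) (η y - η (y - h)) 0 := by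
    rw [e2]
    have i1 := (hg.integral_hasStrictDerivAt 0 0).hasDerivAt
    have i2 := (hg.integral_hasStrictDerivAt 0 (0 - 1)).hasDerivAt
    have := i1.sub (i2.comp_sub_const 0 1)
    refine this.congr_deriv ?_
    simp [sub_eq_add_neg]
  exact e.unique e3

theorem segmentAverage_mem_Icc {n : ℕ} {η : Euc n → ℝ} (hη : Continuous η)
    (h01 : ∀ x, η x ∈ Icc (0 : ℝ) 1) (h y : Euc n) : segmentAverage η h y ∈ Icc (0 : ℝ) 1 := by
  have hc : Continuous fun t : ℝ => η (y - t • h) := by fun_prop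
  refine ⟨intervalIntegral.integral_nonneg zero_le_one fun t _ => (h01 _).1, ?_⟩
  have := intervalIntegral.integral_mono_on (a := 0) (b := 1) zero_le_one
    (hc.intervalIntegrable (μ := volume) 0 1) (continuous_const.intervalIntegrable (μ := volume) 0 1)
    fun t _ => (h01 (y - t • h)).2
  simpa [segmentAverage] using this

/-- The support of the segment average lies in the compact set swept out by the support. -/
theorem exists_isCompact_segmentAverage {n : ℕ} {η : Euc n → ℝ} (h2 : HasCompactSupport η)
    (h : Euc n) {K : Set (Euc n)} (hK : Convex ℝ K)
    (hs : tsupport η ⊆ {x | x ∈ K ∧ x + h ∈ K}) :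
    ∃ S : Set (Euc n), IsCompact S ∧ S ⊆ K ∧ ∀ y ∉ S, segmentAverage η h y = 0 := by
  refine ⟨(fun p : Euc n × ℝ => p.1 + p.2 • h) '' (tsupport η ×ˢ Icc 0 1),
    (h2.isCompact.prod isCompact_Icc).image (by fun_prop), ?_, fun y hy => ?_⟩
  · rintro _ ⟨⟨x, t⟩, ⟨hx, ht⟩, rfl⟩
    exact hK.add_smul_mem (hs hx).1 (hs hx).2 ht
  · rw [segmentAverage, intervalIntegral.integral_of_le zero_le_one]
    refine setIntegral_eq_zero_of_forall_eq_zero fun t ht => ?_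
    refine image_eq_zero_of_notMem_tsupport fun hx => hy ⟨(y - t • h, t), ⟨hx, ?_⟩, ?_⟩
    · exact ⟨ht.1.le, ht.2⟩
    · simp

theorem ofReal_integral_translate_le {n : ℕ} {K E : Set (Euc n)} (hK : Convex ℝ K)
    (hE : MeasurableSet E) {η : Euc n → ℝ} (h1 : ContDiff ℝ 1 η) (h2 : HasCompactSupport η)
    (h01 : ∀ x, η x ∈ Icc (0 : ℝ) 1) {h : Euc n} (hh : h ≠ 0)
    (hs : tsupport η ⊆ {x | x ∈ K ∧ x + h ∈ K}) :
    ENNReal.ofReal (∫ x, (E.indicator (fun _ => (1 : ℝ)) x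
      - E.indicator (fun _ => (1 : ℝ)) (x + h)) * η x) ≤ ENNReal.ofReal ‖h‖ * perim K E := by
  set f : Euc n → ℝ := E.indicator (fun _ => (1 : ℝ)) with hf
  have hn : 0 < ‖h‖ := norm_pos_iff.2 hh
  obtain ⟨S, hS, hSK, hS0⟩ := exists_isCompact_segmentAverage h2 h hK hs
  have hΨ := contDiff_segmentAverage h1 h2 h
  set φ : Euc n → Euc n := fun y => segmentAverage η h y • (‖h‖⁻¹ • h) with hφ
  have hφS : ∀ y ∉ S, φ y = 0 := fun y hy => by simp [hφ, hS0 y hy]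
  have hφs : tsupport φ ⊆ S :=
    closure_minimal (fun y hy => by_contra fun h' => hy (hφS y h')) hS.isClosed
  have hv : ∀ y, vdiv φ y = ‖h‖⁻¹ * (η y - η (y - h)) := fun y => by
    rw [hφ, vdiv_smul_const (hΨ.differentiable one_ne_zero), map_smul,
      fderiv_segmentAverage h1 h2, smul_eq_mul]
  have hP := ofReal_integral_le_perim (Ω := K) E (φ := φ) (hΨ.smul contDiff_const)
    (HasCompactSupport.intro hS hφS) (hφs.trans hSK) fun x => by
      have := segmentAverage_mem_Icc h1.continuous h01 h x
      rw [hφ, norm_smul, norm_smul, norm_inv, norm_norm, inv_mul_cancel₀ hn.ne', mul_one,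
        Real.norm_of_nonneg this.1]
      exact this.2
  rw [setIntegral_mul_vdiv _ (hφs.trans hSK)] at hP
  have hηi : Integrable η := h1.continuous.integrable_of_hasCompactSupport h2
  have hi : ∀ g : Euc n → ℝ, Integrable g → Integrable fun x => f x * g x := fun g hg => by
    rw [hf, indicator_one_mul_eq]
    exact hg.indicator hE
  have i2 : Integrable fun x => f x * η (x - h) := hi _ (hηi.comp_sub_right h)
  have i3 : Integrable fun x => f (x + h) * η x := by
    simpa using i2.comp_add_right h
  have e1 : ∫ x, (f x - f (x + h)) * η x = ∫ x, f x * (η x - η (x - h)) := by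
    simp only [sub_mul, mul_sub]
    rw [integral_sub (hi _ hηi) i3, integral_sub (hi _ hηi) i2]
    congr 1
    rw [← integral_add_right_eq_self (fun x => f x * η (x - h)) h]
    simp
  have e2 : ∫ x, f x * (η x - η (x - h)) = ‖h‖ * ∫ x, f x * vdiv φ x := by
    rw [← integral_const_mul]
    congr 1
    ext x
    rw [hv]
    field_simp
  rw [e1, e2, ENNReal.ofReal_mul hn.le]
  gcongr

theorem exists_contDiff_cutoff {n : ℕ} {C U : Set (Euc n)} (hC : IsCompact C) (hU : IsOpen U)
    (hCU : C ⊆ U) : ∃ η : Euc n → ℝ, ContDiff ℝ 1 η ∧ HasCompactSupport η ∧ tsupport η ⊆ U ∧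
      (∀ x ∈ C, η x = 1) ∧ ∀ x, η x ∈ Icc (0 : ℝ) 1 := by
  obtain ⟨L, hL, hCL, hLU⟩ := exists_compact_between hC hU hCU
  obtain ⟨f, hf0, hf1, hf⟩ := exists_contMDiffMap_zero_one_of_isClosed (n := 1)
    (modelWithCornersSelf ℝ (Euc n)) isOpen_interior.isClosed_compl hC.isClosed
    (disjoint_compl_left_iff_subset.2 hCL)
  have h0 : ∀ x ∉ L, f x = 0 := fun x hx => hf0 fun h => hx (interior_subset h)
  exact ⟨f, f.contMDiff.contDiff, HasCompactSupport.intro hL h0,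
    (closure_minimal (fun y hy => by_contra fun h' => (Function.mem_support.1 hy) (h0 y h')) hL.isClosed).trans hLU,
    fun x hx => hf1 hx, hf⟩

/-- The set of points of `E` that a translation by `h` moves out of `E` inside a convex open set
has measure at most `‖h‖` times the perimeter. -/
theorem volume_translate_le {n : ℕ} {K E : Set (Euc n)} (hK : Convex ℝ K) (hKo : IsOpen K)
    (hE : MeasurableSet E) (h : Euc n) :
    volume {x | x ∈ K ∩ E ∧ x + h ∈ K \ E} ≤ ENNReal.ofReal ‖h‖ * perim K E := by
  rcases eq_or_ne h 0 with rfl | hh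
  · have : {x | x ∈ K ∩ E ∧ x + (0 : Euc n) ∈ K \ E} = ∅ := by
      ext x
      simp +contextual
    rw [this, measure_empty]
    exact zero_le
  have hadd : Measurable fun x : Euc n => x + h := by fun_prop
  have hA : MeasurableSet {x | x ∈ K ∩ E ∧ x + h ∈ K \ E} :=
    (hKo.measurableSet.inter hE).inter (hadd (hKo.measurableSet.diff hE))
  rw [hA.measure_eq_iSup_isCompact]
  refine iSup_le fun C => iSup_le fun hCA => iSup_le fun hC => ?_
  refine ENNReal.le_of_forall_pos_le_add fun ε hε _ => ?_
  obtain ⟨W, hCW, hWo, hW⟩ := hC.exists_isOpen_lt_add (μ := volume)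
    (ENNReal.coe_ne_zero.2 hε.ne')
  have hUo : IsOpen (W ∩ {x | x ∈ K ∧ x + h ∈ K}) :=
    hWo.inter (hKo.inter (hKo.preimage (by fun_prop)))
  obtain ⟨η, h1, h2, h3, hηC, h01⟩ := exists_contDiff_cutoff hC hUo
    (fun x hx => ⟨hCW hx, (hCA hx).1.1, (hCA hx).2.1⟩)
  have hCf : volume C ≠ ⊤ := hC.measure_lt_top.ne
  have hWf : volume W ≠ ⊤ := (hW.trans (by finiteness)).ne
  have hWCf : volume (W \ C) ≠ ⊤ := measure_ne_top_of_subset sdiff_subset hWf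
  have hlow : volume.real C - ε ≤ ∫ x, (E.indicator (fun _ => (1 : ℝ)) x
      - E.indicator (fun _ => (1 : ℝ)) (x + h)) * η x := by
    have i1 : Integrable (C.indicator fun _ => (1 : ℝ)) :=
      (integrable_indicator_iff hC.measurableSet).2 (integrableOn_const hCf)
    have hm : MeasurableSet (W \ C) := hWo.measurableSet.diff hC.measurableSet
    have i2 : Integrable ((W \ C).indicator fun _ => (1 : ℝ)) :=
      (integrable_indicator_iff hm).2 (integrableOn_const hWCf)
    have hd : volume.real (W \ C) ≤ ε := by
      rw [measureReal_def]
      refine ENNReal.toReal_le_of_le_ofReal ε.2 ?_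
      rw [measure_sdiff hCW hC.nullMeasurableSet hCf]
      simpa using tsub_le_iff_left.2 hW.le
    calc volume.real C - ε ≤ volume.real C - volume.real (W \ C) := by linarith
      _ = ∫ x, (C.indicator (fun _ => (1 : ℝ)) x - (W \ C).indicator (fun _ => (1 : ℝ)) x) := by
        rw [integral_sub i1 i2, integral_indicator_const _ hC.measurableSet,
          integral_indicator_const _ hm]
        simp
      _ ≤ _ := by
        refine integral_mono (i1.sub i2) ?_ fun x => ?_
        · have hηi : Integrable η := h1.continuous.integrable_of_hasCompactSupport h2
          refine hηi.bdd_mul (c := 2) ?_ ?_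
          · exact ((measurable_const.indicator hE).sub
              ((measurable_const.indicator hE).comp hadd)).aestronglyMeasurable
          · refine Eventually.of_forall fun x => ?_
            by_cases hx : x ∈ E <;> by_cases hx' : x + h ∈ E <;> simp [hx, hx']
        · by_cases hx : x ∈ C
          · have := hCA hx
            simp [hx, this.1.2, this.2.2, hηC x hx]
          · by_cases hxW : x ∈ W
            · have := h01 x
              by_cases hx1 : x ∈ E <;> by_cases hx2 : x + h ∈ E <;>
                simp [hx, hxW, hx1, hx2] <;> linarith [this.1, this.2]
            · have : η x = 0 := image_eq_zero_of_notMem_tsupport fun hx' => hxW (h3 hx').1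
              simp [hx, hxW, this]
  calc volume C = ENNReal.ofReal (volume.real C) := (ofReal_measureReal hCf).symm
    _ ≤ ENNReal.ofReal ((∫ x, (E.indicator (fun _ => (1 : ℝ)) x
      - E.indicator (fun _ => (1 : ℝ)) (x + h)) * η x) + ε) := by
        gcongr
        linarith
    _ ≤ _ := ENNReal.ofReal_add_le
    _ ≤ ENNReal.ofReal ‖h‖ * perim K E + ε := by
        rw [ENNReal.ofReal_coe_nnreal]
        gcongr
        exact ofReal_integral_translate_le hK hE h1 h2 h01 hh (h3.trans inter_subset_right)

/-- A relative isoperimetric inequality of Poincaré type on bounded convex open sets. -/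
theorem volume_inter_mul_volume_sdiff_le {n : ℕ} {K E : Set (Euc n)} (hK : Convex ℝ K)
    (hKo : IsOpen K) (hE : MeasurableSet E) {d : ℝ} (hd : ∀ x ∈ K, ∀ y ∈ K, dist x y ≤ d) :
    volume (K ∩ E) * volume (K \ E) ≤
      ENNReal.ofReal d * perim K E * volume (closedBall (0 : Euc n) d) := by
  have hA : MeasurableSet (K ∩ E) := hKo.measurableSet.inter hE
  have hB : MeasurableSet (K \ E) := hKo.measurableSet.diff hE
  set S : Set (Euc n × Euc n) := {p | p.1 ∈ K ∩ E ∧ p.1 + p.2 ∈ K \ E} with hS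
  have hSm : MeasurableSet S :=
    (measurable_fst hA).inter ((measurable_fst.add measurable_snd) hB)
  have e1 : (volume.prod volume) S = volume (K ∩ E) * volume (K \ E) := by
    rw [Measure.prod_apply hSm, mul_comm, ← setLIntegral_const, ← lintegral_indicator hA]
    congr 1
    ext x
    by_cases hx : x ∈ K ∩ E
    · rw [indicator_of_mem hx, ← measure_preimage_add volume x (K \ E)]
      congr 1
      ext h
      exact and_iff_right hx
    · rw [indicator_of_notMem hx]
      convert measure_empty (μ := (volume : Measure (Euc n)))
      exact eq_empty_of_forall_notMem fun h hh => hx hh.1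
  have e2 : (volume.prod volume) S ≤
      ENNReal.ofReal d * perim K E * volume (closedBall (0 : Euc n) d) := by
    rw [Measure.prod_apply_symm hSm, ← setLIntegral_const,
      ← lintegral_indicator isClosed_closedBall.measurableSet]
    refine lintegral_mono fun h => ?_
    by_cases hh : h ∈ closedBall (0 : Euc n) d
    · rw [indicator_of_mem hh]
      refine (volume_translate_le hK hKo hE h).trans ?_
      gcongr
      simpa using hh
    · rw [indicator_of_notMem hh, nonpos_iff_eq_zero]
      convert measure_empty (μ := (volume : Measure (Euc n)))
      refine eq_empty_of_forall_notMem fun x hx => hh ?_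
      simpa [dist_eq_norm, norm_neg] using hd x hx.1.1 _ hx.2.1
  exact e1 ▸ e2

theorem volume_ball_inter_scale_le {n : ℕ} {Q : Set (Euc n)} (hQ : Convex ℝ Q) {x : Euc n}
    (hx : x ∈ Q) {t : ℝ} (ht0 : 0 < t) (ht1 : t ≤ 1) (r : ℝ) :
    ENNReal.ofReal (t ^ n) * volume (ball x r ∩ Q) ≤ volume (ball x (t * r) ∩ Q) := by
  have := Measure.addHaar_image_homothety (volume : Measure (Euc n)) x t (ball x r ∩ Q)
  rw [finrank_euclideanSpace_fin, abs_of_pos (by positivity)] at this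
  rw [← this]
  refine measure_mono ?_
  rintro _ ⟨y, ⟨hy, hyQ⟩, rfl⟩
  refine ⟨?_, ?_⟩
  · rw [mem_ball, dist_homothety_center, Real.norm_of_nonneg ht0.le, dist_comm]
    gcongr
    exact hy
  · rw [AffineMap.homothety_eq_lineMap]
    exact hQ.lineMap_mem hx hyQ ⟨ht0.le, ht1⟩

/-- At a density point the set fills more than half of all small dyadic balls. -/
theorem eventually_volume_sdiff_lt {n : ℕ} (hn : 1 ≤ n) {Q A : Set (Euc n)} (hQo : IsOpen Q)
    (hA : MeasurableSet A) {x : Euc n} (hx : x ∈ Q)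
    (hd : Tendsto (fun r => volume (A ∩ closedBall x r) / volume (closedBall x r)) (𝓝[>] 0)
      (𝓝 1)) :
    ∀ᶠ r in 𝓝[>] (0 : ℝ), volume ((ball x r ∩ Q) \ A) < volume ((ball x r ∩ Q) ∩ A) := by
  have : Nonempty (Fin n) := ⟨⟨0, hn⟩⟩
  have hQ' : ∀ᶠ r in 𝓝[>] (0 : ℝ), closedBall x r ⊆ Q :=
    nhdsWithin_le_nhds (eventually_closedBall_subset (hQo.mem_nhds hx))
  filter_upwards [hd.eventually_const_lt ENNReal.one_half_lt_one, hQ', self_mem_nhdsWithin]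
    with r h1 h2 h3
  have h3 : 0 < r := h3
  have hM0 : volume (closedBall x r) ≠ 0 := (measure_closedBall_pos _ _ h3).ne'
  have hMt : volume (closedBall x r) ≠ ⊤ := measure_closedBall_lt_top.ne
  have hbQ : ball x r ∩ Q = ball x r :=
    inter_eq_left.2 (ball_subset_closedBall.trans h2)
  rw [hbQ]
  have hS : volume (closedBall x r ∩ A) ≤ volume (ball x r ∩ A) := by
    calc volume (closedBall x r ∩ A) ≤ volume ((ball x r ∩ A) ∪ sphere x r) := by
          refine measure_mono ?_
          rw [← ball_union_sphere, union_inter_distrib_right]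
          exact union_subset_union_right _ inter_subset_left
      _ ≤ volume (ball x r ∩ A) + volume (sphere x r) := measure_union_le _ _
      _ = volume (ball x r ∩ A) := by rw [Measure.addHaar_sphere, add_zero]
  refine (measure_mono (sdiff_subset_sdiff_left ball_subset_closedBall)).trans_lt
    (lt_of_lt_of_le ?_ hS)
  rw [inter_comm, ENNReal.lt_div_iff_mul_lt (Or.inl hM0) (Or.inl hMt)] at h1
  have h4 := measure_inter_add_sdiff (μ := volume) (closedBall x r) hA
  have h5 : volume (closedBall x r) < volume (closedBall x r ∩ A) + volume (closedBall x r ∩ A) := by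
    rw [← two_mul]
    have := ENNReal.mul_lt_mul_right (a := 2) (by simp) (by simp) h1
    rwa [← mul_assoc, ENNReal.mul_inv_cancel (by simp) (by simp), one_mul] at this
  rw [← h4] at h5
  exact lt_of_add_lt_add_left h5

/-- Stopping-time choice of a radius at which both `A` and its complement fill a definite
proportion of the ball. -/
theorem exists_balanced_radius {n : ℕ} (hn : 1 ≤ n) {Q A : Set (Euc n)} (hQ : Convex ℝ Q)
    (hQo : IsOpen Q) (hQb : Q ⊆ ball 0 1) (hA : MeasurableSet A)
    (hle : volume (Q ∩ A) ≤ volume (Q \ A)) {x : Euc n} (hx : x ∈ Q)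
    (hd : Tendsto (fun r => volume (A ∩ closedBall x r) / volume (closedBall x r)) (𝓝[>] 0)
      (𝓝 1)) :
    ∃ r : ℝ, 0 < r ∧ r ≤ 2 ∧
      volume (ball x r ∩ Q) ≤ 2 ^ (n + 1) * volume ((ball x r ∩ Q) ∩ A) ∧
      volume (ball x r ∩ Q) ≤ 2 * volume ((ball x r ∩ Q) \ A) := by
  set R : ℕ → ℝ := fun k => (1 / 2) ^ k * 2 with hR
  have hRpos : ∀ k, 0 < R k := fun k => by positivity
  have hRlim : Tendsto R atTop (𝓝[>] 0) := by
    refine tendsto_nhdsWithin_iff.2 ⟨?_, Eventually.of_forall hRpos⟩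
    simpa [hR] using (tendsto_pow_atTop_nhds_zero_of_lt_one (r := (1 / 2 : ℝ)) (by norm_num)
      (by norm_num)).mul_const 2
  have hex : ∃ k, volume ((ball x (R k) ∩ Q) \ A) < volume ((ball x (R k) ∩ Q) ∩ A) :=
    (hRlim.eventually (eventually_volume_sdiff_lt hn hQo hA hx hd)).exists
  classical
  have hk := Nat.find_spec hex
  have hmin := fun j => Nat.find_min hex (m := j)
  set k := Nat.find hex
  have hQ2 : ball x (R 0) ∩ Q = Q := by
    refine inter_eq_right.2 fun y hy => ?_
    have h1 := mem_ball_zero_iff.1 (hQb hx)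
    have h2 := mem_ball_zero_iff.1 (hQb hy)
    have := norm_sub_le y x
    rw [mem_ball, dist_eq_norm]
    simp only [hR, pow_zero]
    linarith
  obtain ⟨j, hj⟩ : ∃ j, k = j + 1 := by
    refine Nat.exists_eq_succ_of_ne_zero fun h0 => ?_
    rw [h0, hQ2] at hk
    exact hk.not_ge hle
  have hlej := not_lt.1 (hmin j (by omega))
  rw [hj] at hk
  have hRs : R (j + 1) = 1 / 2 * R j := by simp only [hR, pow_succ]; ring
  refine ⟨R j, hRpos j, ?_, ?_, ?_⟩
  · have : ((1 : ℝ) / 2) ^ j ≤ 1 := pow_le_one₀ (by norm_num) (by norm_num)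
    simp only [hR]
    linarith
  · have hs := volume_ball_inter_scale_le hQ hx (t := 1 / 2) (by norm_num) (by norm_num) (R j)
    rw [← hRs] at hs
    have h2n : ENNReal.ofReal ((1 / 2 : ℝ) ^ n) = (2 ^ n)⁻¹ := by
      rw [ENNReal.ofReal_pow (by norm_num), one_div, ENNReal.ofReal_inv_of_pos (by norm_num),
        ENNReal.inv_pow]
      simp
    rw [h2n] at hs
    calc volume (ball x (R j) ∩ Q)
        = 2 ^ n * ((2 ^ n)⁻¹ * volume (ball x (R j) ∩ Q)) := by
          rw [← mul_assoc, ENNReal.mul_inv_cancel (by positivity) (by finiteness), one_mul]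
      _ ≤ 2 ^ n * volume (ball x (R (j + 1)) ∩ Q) := by gcongr
      _ = 2 ^ n * (volume (ball x (R (j + 1)) ∩ Q ∩ A)
            + volume ((ball x (R (j + 1)) ∩ Q) \ A)) := by rw [measure_inter_add_sdiff _ hA]
      _ ≤ 2 ^ n * (volume (ball x (R (j + 1)) ∩ Q ∩ A)
            + volume (ball x (R (j + 1)) ∩ Q ∩ A)) := by gcongr
      _ = 2 ^ (n + 1) * volume (ball x (R (j + 1)) ∩ Q ∩ A) := by ring
      _ ≤ 2 ^ (n + 1) * volume (ball x (R j) ∩ Q ∩ A) := by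
          gcongr
          rw [hRs]
          linarith [hRpos j]
  · rw [← measure_inter_add_sdiff (ball x (R j) ∩ Q) hA, two_mul]
    gcongr

theorem pow_le_mul_perim {n : ℕ} (hn : 1 ≤ n) {Q E A : Set (Euc n)} (hQ : Convex ℝ Q)
    (hQo : IsOpen Q) (hQb : Q ⊆ ball 0 1) (hE : MeasurableSet E) (hA : A = E ∨ A = Eᶜ)
    {v : ℝ} (hv : 0 < v) (hvQ : v ≤ volume.real Q) {x : Euc n} (hx : x ∈ Q) {r : ℝ}
    (hr : 0 < r) (hr2 : r ≤ 2)
    (hin : volume (ball x r ∩ Q) ≤ 2 ^ (n + 1) * volume ((ball x r ∩ Q) ∩ A))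
    (hout : volume (ball x r ∩ Q) ≤ 2 * volume ((ball x r ∩ Q) \ A))
    (hP : perim (ball x r ∩ Q) E ≠ ⊤) :
    r ^ (n - 1) ≤ 2 ^ (4 * n + 3) * ubv n / v ^ 2 * (perim (ball x r ∩ Q) E).toReal := by
  set K := ball x r ∩ Q with hKdef
  have : Nonempty (Fin n) := ⟨⟨0, hn⟩⟩
  have hKt : volume K ≠ ⊤ := measure_ne_top_of_subset inter_subset_left measure_ball_lt_top.ne
  have hKA : volume (K ∩ A) ≠ ⊤ := measure_ne_top_of_subset inter_subset_left hKt
  have hKA' : volume (K \ A) ≠ ⊤ := measure_ne_top_of_subset sdiff_subset hKt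
  have hpo : volume (K ∩ A) * volume (K \ A) ≤
      ENNReal.ofReal (2 * r) * perim K E * volume (closedBall (0 : Euc n) (2 * r)) := by
    have := volume_inter_mul_volume_sdiff_le (K := K) ((convex_ball x r).inter hQ)
      (isOpen_ball.inter hQo) hE (d := 2 * r) fun y hy z hz => by
        have h1 := mem_ball.1 hy.1
        have h2 := mem_ball'.1 hz.1
        linarith [dist_triangle y x z]
    rcases hA with rfl | rfl
    · exact this
    · rw [sdiff_compl, mul_comm, ← sdiff_eq]
      exact this
  have hpo' : volume.real (K ∩ A) * volume.real (K \ A) ≤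
      2 * r * (perim K E).toReal * ((2 * r) ^ n * ubv n) := by
    have h := ENNReal.toReal_mono (ENNReal.mul_ne_top
      (ENNReal.mul_ne_top ENNReal.ofReal_ne_top hP) measure_closedBall_lt_top.ne) hpo
    rw [Measure.addHaar_closedBall _ _ (by positivity : 0 ≤ 2 * r)] at h
    simp only [ENNReal.toReal_mul, finrank_euclideanSpace_fin] at h
    rwa [ENNReal.toReal_ofReal (by positivity), ENNReal.toReal_ofReal (by positivity)] at h
  have hin' : volume.real K ≤ 2 ^ (n + 1) * volume.real (K ∩ A) := by
    simpa [measureReal_def] using ENNReal.toReal_mono (by finiteness) hin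
  have hout' : volume.real K ≤ 2 * volume.real (K \ A) := by
    simpa [measureReal_def] using ENNReal.toReal_mono (by finiteness) hout
  have hsc : (r / 2) ^ n * v ≤ volume.real K := by
    have h := volume_ball_inter_scale_le hQ hx (t := r / 2) (by positivity) (by linarith) 2
    rw [div_mul_cancel₀ _ (two_ne_zero)] at h
    have hQ2 : ball x 2 ∩ Q = Q := by
      refine inter_eq_right.2 fun y hy => ?_
      have h1 := mem_ball_zero_iff.1 (hQb hx)
      have h2 := mem_ball_zero_iff.1 (hQb hy)
      have := norm_sub_le y x
      rw [mem_ball, dist_eq_norm]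
      linarith
    rw [hQ2] at h
    have h' := ENNReal.toReal_mono hKt h
    rw [ENNReal.toReal_mul, ENNReal.toReal_ofReal (by positivity)] at h'
    exact (mul_le_mul_of_nonneg_left hvQ (by positivity)).trans h'
  have hprod : ((r / 2) ^ n * v) * ((r / 2) ^ n * v) ≤
      (2 ^ (n + 1) * volume.real (K ∩ A)) * (2 * volume.real (K \ A)) :=
    mul_le_mul (hsc.trans hin') (hsc.trans hout') (by positivity) (by positivity)
  rw [div_mul_eq_mul_div, le_div_iff₀ (by positivity)]
  obtain ⟨m, rfl⟩ : ∃ m, n = m + 1 := ⟨n - 1, by omega⟩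
  rw [Nat.add_sub_cancel]
  refine le_of_mul_le_mul_left ?_ (by positivity : 0 < r ^ (m + 2) / 2 ^ (2 * (m + 1)))
  calc r ^ (m + 2) / 2 ^ (2 * (m + 1)) * (r ^ m * v ^ 2)
      = ((r / 2) ^ (m + 1) * v) * ((r / 2) ^ (m + 1) * v) := by
        rw [div_pow]
        field_simp
        ring
    _ ≤ 2 ^ (m + 1 + 2) * (volume.real (K ∩ A) * volume.real (K \ A)) := by
        refine hprod.trans (le_of_eq ?_)
        ring
    _ ≤ 2 ^ (m + 1 + 2) * (2 * r * (perim K E).toReal * ((2 * r) ^ (m + 1) * ubv (m + 1))) := by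
        gcongr
    _ = r ^ (m + 2) / 2 ^ (2 * (m + 1)) *
        (2 ^ (4 * (m + 1) + 3) * ubv (m + 1) * (perim K E).toReal) := by
        rw [mul_pow]
        field_simp
        ring

theorem tsum_rpow_le_rpow_tsum {ι : Type*} (a : ι → ℝ≥0∞) {p : ℝ} (hp : 1 ≤ p) :
    ∑' i, a i ^ p ≤ (∑' i, a i) ^ p := by
  have h : ∀ x : ℝ≥0∞, x ^ p = x * x ^ (p - 1) := fun x => by
    conv_lhs => rw [← add_sub_cancel 1 p,
      ENNReal.rpow_add_of_nonneg _ _ zero_le_one (sub_nonneg.2 hp), ENNReal.rpow_one]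
  simp only [h]
  rw [← ENNReal.tsum_mul_right]
  refine ENNReal.tsum_le_tsum fun i => ?_
  gcongr
  exact ENNReal.le_tsum i

/-- One-sided relative isoperimetric inequality in a convex open subset of the unit ball, with a
constant depending only on the dimension and a lower bound on the volume of the subset. -/
theorem volume_inter_le_perim_rpow {n : ℕ} (hn : 2 ≤ n) {Q E A : Set (Euc n)} (hQ : Convex ℝ Q)
    (hQo : IsOpen Q) (hQb : Q ⊆ ball 0 1) (hE : MeasurableSet E) (hA : A = E ∨ A = Eᶜ)
    {v : ℝ} (hv : 0 < v) (hvQ : v ≤ volume.real Q) (hP : perim Q E ≠ ⊤)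
    (hle : volume (Q ∩ A) ≤ volume (Q \ A)) :
    volume (Q ∩ A) ≤ ENNReal.ofReal (5 ^ n) * volume (ball (0 : Euc n) 1) *
      (ENNReal.ofReal (2 ^ (4 * n + 3) * ubv n / v ^ 2) * perim Q E) ^
        ((n : ℝ) / ((n : ℝ) - 1)) := by
  set C : ℝ := 2 ^ (4 * n + 3) * ubv n / v ^ 2 with hC
  set p : ℝ := (n : ℝ) / ((n : ℝ) - 1) with hp
  have hn1 : (0 : ℝ) < n - 1 := by
    have : (2 : ℝ) ≤ n := by exact_mod_cast hn
    linarith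
  have hp1 : 1 ≤ p := by
    rw [hp, le_div_iff₀ hn1]
    linarith
  have hC0 : 0 ≤ C := by
    have : 0 ≤ ubv n := ENNReal.toReal_nonneg
    positivity
  have hAm : MeasurableSet A := by
    rcases hA with rfl | rfl
    exacts [hE, hE.compl]
  set G : Set (Euc n) := {x | x ∈ Q ∧ Tendsto
    (fun r => volume (A ∩ closedBall x r) / volume (closedBall x r)) (𝓝[>] 0) (𝓝 1)} with hG
  have hex : ∀ x ∈ G, ∃ r : ℝ, 0 < r ∧ r ≤ 2 ∧
      ENNReal.ofReal (r ^ n) ≤ (ENNReal.ofReal C * perim (ball x r ∩ Q) E) ^ p := by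
    rintro x ⟨hx, hd⟩
    obtain ⟨r, hr, hr2, hin, hout⟩ :=
      exists_balanced_radius (by omega) hQ hQo hQb hAm hle hx hd
    have hPK : perim (ball x r ∩ Q) E ≠ ⊤ :=
      ((perim_mono E inter_subset_right).trans_lt hP.lt_top).ne
    have h := pow_le_mul_perim (by omega) hQ hQo hQb hE hA hv hvQ hx hr hr2 hin hout hPK
    refine ⟨r, hr, hr2, ?_⟩
    have e : r ^ n = (r ^ (n - 1)) ^ p := by
      rw [← Real.rpow_natCast r (n - 1), ← Real.rpow_mul hr.le, Nat.cast_sub (by omega),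
        Nat.cast_one, hp, mul_div_cancel₀ _ hn1.ne', Real.rpow_natCast]
    rw [e, ← ENNReal.ofReal_rpow_of_nonneg (by positivity) (by linarith)]
    gcongr
    rw [← ENNReal.ofReal_toReal hPK, ← ENNReal.ofReal_mul hC0]
    exact ENNReal.ofReal_le_ofReal h
  choose! ρ hρ0 hρ2 hρ using hex
  obtain ⟨u, huG, hud, hcov⟩ := Vitali.exists_disjoint_subfamily_covering_enlargement_closedBall
    G id ρ 2 hρ2 5 (by norm_num)
  have hucount : u.Countable := hud.countable_of_nonempty_interior fun x hx =>
    ⟨x, ball_subset_interior_closedBall (mem_ball_self (hρ0 x (huG hx)))⟩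
  have hae : (Q ∩ A : Set (Euc n)) ≤ᵐ[volume] ⋃ b ∈ u, closedBall b (5 * ρ b) := by
    filter_upwards [Besicovitch.ae_tendsto_measure_inter_div_of_measurableSet volume hAm]
      with x hx hxQA
    rw [indicator_of_mem hxQA.2] at hx
    have hxG : x ∈ G := ⟨hxQA.1, hx⟩
    obtain ⟨b, hb, hsub⟩ := hcov x hxG
    exact mem_iUnion₂.2 ⟨b, hb, hsub (mem_closedBall_self (hρ0 x hxG).le)⟩
  have hdis : Pairwise (Function.onFun Disjoint fun b : u => ball (b : Euc n) (ρ b) ∩ Q) :=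
    fun b c hbc => (hud b.2 c.2 (Subtype.coe_injective.ne hbc)).mono
      (inter_subset_left.trans ball_subset_closedBall)
      (inter_subset_left.trans ball_subset_closedBall)
  calc volume (Q ∩ A) ≤ volume (⋃ b ∈ u, closedBall b (5 * ρ b)) := measure_mono_ae hae
    _ ≤ ∑' b : u, volume (closedBall (b : Euc n) (5 * ρ b)) := measure_biUnion_le _ hucount _
    _ ≤ ∑' b : u, ENNReal.ofReal (5 ^ n) * volume (ball (0 : Euc n) 1) *
        (ENNReal.ofReal C * perim (ball (b : Euc n) (ρ b) ∩ Q) E) ^ p := by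
      refine ENNReal.tsum_le_tsum fun b => ?_
      have hb := huG b.2
      rw [Measure.addHaar_closedBall _ _ (by have := hρ0 _ hb; positivity),
        finrank_euclideanSpace_fin, mul_pow, ENNReal.ofReal_mul (by positivity), mul_right_comm]
      gcongr
      exact hρ _ hb
    _ ≤ ENNReal.ofReal (5 ^ n) * volume (ball (0 : Euc n) 1) *
        (∑' b : u, ENNReal.ofReal C * perim (ball (b : Euc n) (ρ b) ∩ Q) E) ^ p := by
      rw [ENNReal.tsum_mul_left]
      gcongr
      exact tsum_rpow_le_rpow_tsum _ hp1
    _ ≤ _ := by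
      rw [ENNReal.tsum_mul_left]
      gcongr
      exact tsum_perim_le hE _ (fun _ => inter_subset_right) hdis

/-- Isoperimetric inequality in a spherical segment
`Q = {x : Σᵢ xᵢ² < 1, a < xₙ < 1}`, `a ≤ 1/2`:
`min (Hₙ(Q ∩ E), Hₙ(Q \ E)) ≤ cₙ P_Q(E)^{n/(n-1)}` with `cₙ > 0` depending only on `n`. -/
theorem statement0 (n : ℕ) (hn : 2 ≤ n) :
    ∃ c : ℝ, 0 < c ∧
      ∀ a : ℝ, a ≤ 1 / 2 →
        ∀ E : Set (Euc n), MeasurableSet E → perim univ E < ⊤ →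
          min (volume ({x : Euc n | (∑ i, x i ^ 2) < 1 ∧
                  a < x ⟨n - 1, by omega⟩ ∧ x ⟨n - 1, by omega⟩ < 1} ∩ E))
              (volume ({x : Euc n | (∑ i, x i ^ 2) < 1 ∧
                  a < x ⟨n - 1, by omega⟩ ∧ x ⟨n - 1, by omega⟩ < 1} \ E)) ≤
            ENNReal.ofReal c *
              perim {x : Euc n | (∑ i, x i ^ 2) < 1 ∧
                  a < x ⟨n - 1, by omega⟩ ∧ x ⟨n - 1, by omega⟩ < 1} E ^
                ((n : ℝ) / ((n : ℝ) - 1)) := by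
  have hi : n - 1 < n := by omega
  set i : Fin n := ⟨n - 1, hi⟩ with hidef
  have : Nonempty (Fin n) := ⟨i⟩
  have hω : 0 < ubv n :=
    ENNReal.toReal_pos (measure_ball_pos _ _ one_pos).ne' measure_ball_lt_top.ne
  have hn1 : (0 : ℝ) < n - 1 := by
    have : (2 : ℝ) ≤ n := by exact_mod_cast hn
    linarith
  set p : ℝ := (n : ℝ) / ((n : ℝ) - 1) with hp
  have hp0 : 0 ≤ p := by positivity
  set v : ℝ := (1 / 4) ^ n * ubv n with hv
  set C : ℝ := 2 ^ (4 * n + 3) * ubv n / v ^ 2 with hC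
  have hC0 : 0 < C := by positivity
  refine ⟨5 ^ n * ubv n * C ^ p, by positivity, fun a ha E hE hPE => ?_⟩
  set Q : Set (Euc n) := {x : Euc n | (∑ j, x j ^ 2) < 1 ∧ a < x i ∧ x i < 1} with hQdef
  have hball : ∀ x : Euc n, (∑ j, x j ^ 2) < 1 ↔ x ∈ ball (0 : Euc n) 1 := fun x => by
    rw [mem_ball_zero_iff, ← sq_lt_one_iff₀ (norm_nonneg x), EuclideanSpace.real_norm_sq_eq]
  have hQeq : Q = ball (0 : Euc n) 1 ∩ (EuclideanSpace.proj (𝕜 := ℝ) i ⁻¹' Ioo a 1) := by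
    ext x
    exact and_congr (hball x) Iff.rfl
  have hQb : Q ⊆ ball 0 1 := hQeq ▸ inter_subset_left
  have hQo : IsOpen Q := by
    rw [hQeq]
    exact isOpen_ball.inter (isOpen_Ioo.preimage (EuclideanSpace.proj (𝕜 := ℝ) i).continuous)
  have hQc : Convex ℝ Q := by
    rw [hQeq]
    exact (convex_ball _ _).inter
      ((convex_Ioo a 1).linear_preimage (EuclideanSpace.proj (𝕜 := ℝ) i).toLinearMap)
  have hvQ : v ≤ volume.real Q := by
    have hsub : ball (EuclideanSpace.single i (3 / 4 : ℝ)) (1 / 4) ⊆ Q := by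
      intro y hy
      rw [mem_ball, dist_eq_norm] at hy
      have h1 : ‖y‖ < 1 := by
        have := norm_le_norm_sub_add y (EuclideanSpace.single i (3 / 4 : ℝ))
        rw [PiLp.norm_single] at this
        norm_num at this
        linarith
      have h2 := (PiLp.norm_apply_le (y - EuclideanSpace.single i (3 / 4 : ℝ)) i).trans_lt hy
      have h3 := (PiLp.norm_apply_le y i).trans_lt h1
      rw [Real.norm_eq_abs, abs_lt] at h2 h3
      simp only [PiLp.sub_apply, PiLp.single_apply, if_true] at h2
      refine ⟨(hball y).2 (mem_ball_zero_iff.2 h1), ?_, h3.2⟩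
      linarith [h2.1]
    calc v = volume.real (ball (EuclideanSpace.single i (3 / 4 : ℝ)) (1 / 4)) := by
          rw [measureReal_def, Measure.addHaar_ball _ _ (by norm_num), ENNReal.toReal_mul,
            ENNReal.toReal_ofReal (by positivity), finrank_euclideanSpace_fin, hv, ubv]
      _ ≤ volume.real Q := measureReal_mono hsub
          (measure_ne_top_of_subset hQb measure_ball_lt_top.ne)
  have hPQ : perim Q E ≠ ⊤ := ((perim_mono E (subset_univ Q)).trans_lt hPE).ne
  have hc : ENNReal.ofReal (5 ^ n * ubv n * C ^ p) * perim Q E ^ p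
      = ENNReal.ofReal (5 ^ n) * volume (ball (0 : Euc n) 1)
        * (ENNReal.ofReal C * perim Q E) ^ p := by
    rw [ENNReal.mul_rpow_of_nonneg _ _ hp0, ENNReal.ofReal_rpow_of_pos hC0,
      ENNReal.ofReal_mul (by positivity), ENNReal.ofReal_mul (by positivity), ubv,
      ENNReal.ofReal_toReal measure_ball_lt_top.ne, mul_assoc]
  rw [hc]
  rcases le_total (volume (Q ∩ E)) (volume (Q \ E)) with hle | hle
  · exact (min_le_left _ _).trans (volume_inter_le_perim_rpow hn hQc hQo hQb hE (Or.inl rfl)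
      (by positivity) hvQ hPQ hle)
  · refine (min_le_right _ _).trans ?_
    rw [sdiff_eq]
    refine volume_inter_le_perim_rpow hn hQc hQo hQb hE (Or.inr rfl) (by positivity) hvQ hPQ ?_
    rwa [← sdiff_eq, sdiff_compl]

end
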